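/- arXiv:1409.3323 — 3 statements merged into one kernel-verified Lean document; each statement's English description precedes it below -/
import Mathlib

section
/- For every n, M ≥ 1, every type promise T ⊆ [M]^n, and every partial function f : T → Bool, the certificate complexity satisfies C(f) ≤ 3 · bs(f) · s(f). -/
open scoped Classical

namespace QCPaper

/-- A partial assignment `c` is consistent with the input `x` if it agrees with `x`
wherever it is defined. -/
def Consistent {n M : ℕ} (c : Fin n → Option (Fin M)) (x : Fin n → Fin M) : Prop :=
  ∀ i : Fin n, ∀ a : Fin M, c i = some a → x i = a

/-- The size of a partial assignment: the number of indices where it is defined. -/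
def paSize {n M : ℕ} (c : Fin n → Option (Fin M)) : ℕ :=
  (Finset.univ.filter fun i => c i ≠ none).card

/-- `c` is a certificate for the partial function `f` with promise `X`:
all inputs in `X` consistent with `c` get the same value under `f`. -/
def IsCertificate {n M : ℕ} (X : Set (Fin n → Fin M)) (f : (Fin n → Fin M) → Bool)
    (c : Fin n → Option (Fin M)) : Prop :=
  ∀ x ∈ X, ∀ y ∈ X, Consistent c x → Consistent c y → f x = f y

/-- The certificate complexity of `f` at the input `x`:
the least size of a certificate for `f` consistent with `x`. -/
noncomputable def Cx {n M : ℕ} (X : Set (Fin n → Fin M)) (f : (Fin n → Fin M) → Bool)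
    (x : Fin n → Fin M) : ℕ :=
  sInf {k | ∃ c : Fin n → Option (Fin M),
    IsCertificate X f c ∧ Consistent c x ∧ paSize c = k}

/-- The certificate complexity `C(f)`: the maximum of `Cx` over inputs in the promise. -/
noncomputable def certC {n M : ℕ} (X : Set (Fin n → Fin M))
    (f : (Fin n → Fin M) → Bool) : ℕ :=
  sSup {k | ∃ x ∈ X, Cx X f x = k}

/-- `b` is a sensitive block of `x` for `f` (with promise `X`). -/
def SensBlock {n M : ℕ} (X : Set (Fin n → Fin M)) (f : (Fin n → Fin M) → Bool)
    (x : Fin n → Fin M) (b : Finset (Fin n)) : Prop :=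
  ∃ y ∈ X, f y ≠ f x ∧ ∀ i : Fin n, y i ≠ x i → i ∈ b

/-- The block sensitivity of `f` at `x`: the largest number of pairwise disjoint
sensitive blocks of `x`. -/
noncomputable def bsx {n M : ℕ} (X : Set (Fin n → Fin M)) (f : (Fin n → Fin M) → Bool)
    (x : Fin n → Fin M) : ℕ :=
  sSup {m | ∃ b : Fin m → Finset (Fin n),
    (∀ j, SensBlock X f x (b j)) ∧ ∀ j j', j ≠ j' → Disjoint (b j) (b j')}

/-- The block sensitivity `bs(f)`. -/
noncomputable def bs {n M : ℕ} (X : Set (Fin n → Fin M))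
    (f : (Fin n → Fin M) → Bool) : ℕ :=
  sSup {m | ∃ x ∈ X, bsx X f x = m}

/-- The sensitivity of `f` at `x`: the largest number of pairwise disjoint
sensitive blocks of `x`, each of size 2. -/
noncomputable def sx {n M : ℕ} (X : Set (Fin n → Fin M)) (f : (Fin n → Fin M) → Bool)
    (x : Fin n → Fin M) : ℕ :=
  sSup {m | ∃ b : Fin m → Finset (Fin n),
    (∀ j, SensBlock X f x (b j) ∧ (b j).card = 2) ∧ ∀ j j', j ≠ j' → Disjoint (b j) (b j')}

/-- The sensitivity `s(f)`. -/
noncomputable def sens {n M : ℕ} (X : Set (Fin n → Fin M))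
    (f : (Fin n → Fin M) → Bool) : ℕ :=
  sSup {m | ∃ x ∈ X, sx X f x = m}

/-- The type of an input: the multiset of its entries. -/
def typeOf {n M : ℕ} (x : Fin n → Fin M) : Multiset (Fin M) :=
  Finset.univ.val.map x

/-- The multiplicity of the alphabet element `a` in the input `x`. -/
def mult {n M : ℕ} (x : Fin n → Fin M) (a : Fin M) : ℕ :=
  (Finset.univ.filter fun i => x i = a).card

/-- A type promise: the (nonempty) set of all strings with one fixed type. -/
def IsTypePromise {n M : ℕ} (T : Set (Fin n → Fin M)) : Prop :=
  ∃ x₀ : Fin n → Fin M, T = {x | typeOf x = typeOf x₀}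

/-- Decision trees over `[M]^n`: either a leaf with a Boolean answer, or a query
to an index together with a subtree for each possible answer. -/
inductive DTree (n M : ℕ) : Type
  | leaf : Bool → DTree n M
  | node : Fin n → (Fin M → DTree n M) → DTree n M

/-- Evaluation of a decision tree on an input. -/
def DTree.eval {n M : ℕ} : DTree n M → (Fin n → Fin M) → Bool
  | .leaf b, _ => b
  | .node i ts, x => (ts (x i)).eval x

/-- The cost of a decision tree on an input: the number of queries made. -/
def DTree.cost {n M : ℕ} : DTree n M → (Fin n → Fin M) → ℕ
  | .leaf _, _ => 0
  | .node i ts, x => (ts (x i)).cost x + 1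

/-- The depth of a decision tree: its maximum cost over all inputs. -/
def DTree.depth {n M : ℕ} : DTree n M → ℕ
  | .leaf _ => 0
  | .node _ ts => (Finset.univ.sup fun a => (ts a).depth) + 1

/-- The tree `t` computes `f` on the promise `X`. -/
def Computes {n M : ℕ} (X : Set (Fin n → Fin M)) (f : (Fin n → Fin M) → Bool)
    (t : DTree n M) : Prop :=
  ∀ x ∈ X, t.eval x = f x

/-- The deterministic query complexity `D(f)`:
the least depth of a decision tree computing `f`. -/
noncomputable def detD {n M : ℕ} (X : Set (Fin n → Fin M))
    (f : (Fin n → Fin M) → Bool) : ℕ :=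
  sInf {d | ∃ t : DTree n M, Computes X f t ∧ t.depth = d}

/-- A finitely supported probability distribution over decision trees,
given as a finite list of trees with probabilities. -/
structure RandAlg (n M : ℕ) where
  N : ℕ
  tree : Fin N → DTree n M
  prob : Fin N → ℝ
  nonneg : ∀ j, 0 ≤ prob j
  sum_one : ∑ j, prob j = 1

/-- The expected cost of a randomized algorithm on the input `x`. -/
noncomputable def expCost {n M : ℕ} (A : RandAlg n M) (x : Fin n → Fin M) : ℝ :=
  ∑ j, A.prob j * ((A.tree j).cost x : ℝ)

/-- `A` is a zero-error randomized algorithm for `f`: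
every tree in its support computes `f`. -/
def ZeroError {n M : ℕ} (X : Set (Fin n → Fin M)) (f : (Fin n → Fin M) → Bool)
    (A : RandAlg n M) : Prop :=
  ∀ j, A.prob j ≠ 0 → Computes X f (A.tree j)

/-- The cost of a randomized algorithm: the maximum over inputs in the promise of
the expected cost. -/
noncomputable def algCost {n M : ℕ} (X : Set (Fin n → Fin M)) (A : RandAlg n M) : ℝ :=
  sSup {r | ∃ x ∈ X, r = expCost A x}

/-- The zero-error randomized query complexity `R₀(f)`:
the infimum cost of a zero-error randomized algorithm for `f`. -/
noncomputable def R0 {n M : ℕ} (X : Set (Fin n → Fin M))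
    (f : (Fin n → Fin M) → Bool) : ℝ :=
  sInf {r | ∃ A : RandAlg n M, ZeroError X f A ∧ algCost X A = r}

/-- `A` is a bounded-error randomized algorithm for `f`: on every input in the promise,
it returns the correct answer with probability at least 2/3. -/
def BoundedError {n M : ℕ} (X : Set (Fin n → Fin M)) (f : (Fin n → Fin M) → Bool)
    (A : RandAlg n M) : Prop :=
  ∀ x ∈ X, (2/3 : ℝ) ≤ ∑ j ∈ Finset.univ.filter fun j => (A.tree j).eval x = f x, A.prob j

/-- The depth of a randomized algorithm: the maximum depth of a tree in its support. -/
noncomputable def suppDepth {n M : ℕ} (A : RandAlg n M) : ℕ :=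
  (Finset.univ.filter fun j => A.prob j ≠ 0).sup fun j => (A.tree j).depth

/-- The bounded-error randomized query complexity `R(f)`:
the least depth of a bounded-error randomized algorithm for `f`. -/
noncomputable def randR {n M : ℕ} (X : Set (Fin n → Fin M))
    (f : (Fin n → Fin M) → Bool) : ℕ :=
  sInf {d | ∃ A : RandAlg n M, BoundedError X f A ∧ suppDepth A = d}

/-- A set of inputs is symmetric if it is invariant under permuting coordinates. -/
def SymmetricSet {n M : ℕ} (X : Set (Fin n → Fin M)) : Prop :=
  ∀ x ∈ X, ∀ σ : Equiv.Perm (Fin n), (x ∘ σ) ∈ X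

/-- A function is symmetric if its value depends only on the type of the input. -/
def SymmetricFun {n M : ℕ} (X : Set (Fin n → Fin M))
    (f : (Fin n → Fin M) → Bool) : Prop :=
  ∀ x ∈ X, ∀ y ∈ X, typeOf x = typeOf y → f x = f y

/-- The measure `d(f)` for a non-constant symmetric function: the least distance between
the types of two inputs in the promise with different values under `f`. -/
noncomputable def dgap {n M : ℕ} (X : Set (Fin n → Fin M))
    (f : (Fin n → Fin M) → Bool) : ℕ :=
  sInf {d | ∃ x ∈ X, ∃ y ∈ X, f x ≠ f y ∧
    (Finset.univ.sup fun a => Nat.dist (mult x a) (mult y a)) = d}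

/-- A fixed-point-free permutation has a large set disjoint from its image. -/
theorem exists_independent_of_fixedPointFree {α : Type*} [Fintype α] (σ : Equiv.Perm α)
    (hσ : ∀ a, σ a ≠ a) :
    ∃ P : Finset α, (∀ p ∈ P, σ p ∉ P) ∧ Fintype.card α ≤ 3 * P.card := by
  obtain ⟨P, hP⟩ := Set.Finite.exists_maximal
    (Set.toFinite {P : Finset α | ∀ p ∈ P, σ p ∉ P}) ⟨∅, by simp⟩
  refine ⟨P, hP.prop, ?_⟩
  have hcover : (Finset.univ : Finset α) ⊆ (P ∪ P.image σ) ∪ P.image σ.symm := by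
    intro v _
    by_contra hv
    simp only [Finset.mem_union, Finset.mem_image, not_or, not_exists, not_and] at hv
    obtain ⟨⟨hv₁, hv₂⟩, hv₃⟩ := hv
    refine hv₁ (hP.le_of_ge (y := insert v P) ?_ (Finset.subset_insert v P)
      (Finset.mem_insert_self v P))
    intro p hp hp'
    rcases Finset.mem_insert.1 hp with rfl | hp
    · rcases Finset.mem_insert.1 hp' with h | h
      · exact hσ p h
      · exact hv₃ _ h (by simp)
    · rcases Finset.mem_insert.1 hp' with h | h
      · exact hv₂ p hp h
      · exact hP.prop p hp h
  calc Fintype.card α ≤ ((P ∪ P.image σ) ∪ P.image σ.symm).card :=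
        Finset.card_le_card hcover
    _ ≤ P.card + (P.image σ).card + (P.image σ.symm).card :=
        (Finset.card_union_le _ _).trans (Nat.add_le_add_right (Finset.card_union_le _ _) _)
    _ ≤ 3 * P.card := by
        have h₁ := Finset.card_image_le (s := P) (f := σ)
        have h₂ := Finset.card_image_le (s := P) (f := σ.symm)
        omega

theorem SensBlock.nonempty {n M : ℕ} {X : Set (Fin n → Fin M)} {f : (Fin n → Fin M) → Bool}
    {x : Fin n → Fin M} {b : Finset (Fin n)} (h : SensBlock X f x b) : b.Nonempty := by
  obtain ⟨y, -, hf, hb⟩ := h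
  by_contra hne
  rw [Finset.not_nonempty_iff_eq_empty] at hne
  subst hne
  exact hf (congrArg f (funext fun i => by_contra fun hi => by simpa using hb i hi))

/-- Pairwise disjoint nonempty subsets of `Fin n` number at most `n`. -/
theorem card_le_of_disjoint_nonempty {n m : ℕ} (b : Fin m → Finset (Fin n))
    (hne : ∀ j, (b j).Nonempty) (hd : ∀ j j', j ≠ j' → Disjoint (b j) (b j')) : m ≤ n := by
  choose g hg using hne
  have hinj : Function.Injective g := fun j j' h => by
    by_contra hjj
    exact Finset.disjoint_left.1 (hd j j' hjj) (hg j) (h ▸ hg j')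
  simpa using Fintype.card_le_of_injective g hinj

theorem bddAbove_packings {n M : ℕ} (X : Set (Fin n → Fin M)) (f : (Fin n → Fin M) → Bool)
    (x : Fin n → Fin M) :
    BddAbove {m | ∃ b : Fin m → Finset (Fin n),
      (∀ j, SensBlock X f x (b j)) ∧ ∀ j j', j ≠ j' → Disjoint (b j) (b j')} :=
  ⟨n, fun _ ⟨b, hb, hd⟩ => card_le_of_disjoint_nonempty b (fun j => (hb j).nonempty) hd⟩

theorem le_bsx {n M m : ℕ} {X : Set (Fin n → Fin M)} {f : (Fin n → Fin M) → Bool}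
    {x : Fin n → Fin M} (b : Fin m → Finset (Fin n)) (hb : ∀ j, SensBlock X f x (b j))
    (hd : ∀ j j', j ≠ j' → Disjoint (b j) (b j')) : m ≤ bsx X f x :=
  le_csSup (bddAbove_packings X f x) ⟨b, hb, hd⟩

theorem bsx_le_bs {n M : ℕ} {X : Set (Fin n → Fin M)} (f : (Fin n → Fin M) → Bool)
    {x : Fin n → Fin M} (hx : x ∈ X) : bsx X f x ≤ bs X f :=
  le_csSup ((Set.toFinite (bsx X f '' X)).bddAbove) ⟨x, hx, rfl⟩

theorem sx_le_sens {n M : ℕ} {X : Set (Fin n → Fin M)} (f : (Fin n → Fin M) → Bool)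
    {x : Fin n → Fin M} (hx : x ∈ X) : sx X f x ≤ sens X f :=
  le_csSup ((Set.toFinite (sx X f '' X)).bddAbove) ⟨x, hx, rfl⟩

theorem card_le_sx {n M : ℕ} {X : Set (Fin n → Fin M)} {f : (Fin n → Fin M) → Bool}
    {x : Fin n → Fin M} {ι : Type*} (P : Finset ι) (b : ι → Finset (Fin n))
    (hb : ∀ p ∈ P, SensBlock X f x (b p) ∧ (b p).card = 2)
    (hd : ∀ p ∈ P, ∀ q ∈ P, p ≠ q → Disjoint (b p) (b q)) : P.card ≤ sx X f x := by
  refine le_csSup ⟨n, fun m ⟨c, hc, hcd⟩ =>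
    card_le_of_disjoint_nonempty c (fun j => (hc j).1.nonempty) hcd⟩
    ⟨fun j => b (P.equivFin.symm j), fun j => hb _ (P.equivFin.symm j).2, fun j j' hjj => ?_⟩
  exact hd _ (P.equivFin.symm j).2 _ (P.equivFin.symm j').2
    (fun h => hjj (P.equivFin.symm.injective (Subtype.ext h)))

/-- Functions with the same multiset of values differ by a permutation of the domain. -/
theorem exists_perm_of_map_univ_eq {α β : Type*} [Fintype α] {u v : α → β}
    (h : (Finset.univ : Finset α).val.map u = (Finset.univ : Finset α).val.map v) :
    ∃ σ : Equiv.Perm α, ∀ i, v (σ i) = u i := by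
  have hcard (a : β) : Fintype.card {i // u i = a} = Fintype.card {i // v i = a} := by
    have ha := congrArg (Multiset.count a) h
    rw [Multiset.count_map, Multiset.count_map] at ha
    simpa only [Fintype.card_subtype, Finset.card_def, Finset.filter_val, eq_comm] using ha
  let e (a : β) : {i // u i = a} ≃ {i // v i = a} := Fintype.equivOfCardEq (hcard a)
  exact ⟨(Equiv.sigmaFiberEquiv u).symm.trans
    ((Equiv.sigmaCongrRight e).trans (Equiv.sigmaFiberEquiv v)), fun i => (e (u i) ⟨i, rfl⟩).2⟩

/-- Two inputs of the same type that agree outside `b` are rearrangements of each other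
inside `b`. -/
theorem exists_perm_of_typeOf_eq {n M : ℕ} {x y : Fin n → Fin M} (h : typeOf x = typeOf y)
    {b : Finset (Fin n)} (hb : ∀ i, y i ≠ x i → i ∈ b) :
    ∃ σ : Equiv.Perm b, ∀ i : b, y (σ i) = x i := by
  have hsplit (z : Fin n → Fin M) : typeOf z = b.val.map z + bᶜ.val.map z := by
    rw [typeOf, ← Multiset.map_add, ← Finset.union_compl b,
      ← Finset.disjUnion_eq_union _ _ disjoint_compl_right, Finset.disjUnion_val]
  have hc : bᶜ.val.map x = bᶜ.val.map y := Multiset.map_congr rfl fun i hi => by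
    by_contra hne
    exact (Finset.mem_compl.1 hi) (hb i (Ne.symm hne))
  rw [hsplit x, hsplit y, hc, add_left_inj] at h
  have hsub (z : Fin n → Fin M) :
      (Finset.univ : Finset b).val.map (fun i : b => z i) = b.val.map z :=
    Multiset.attach_map_val' b.val z
  rw [← hsub x, ← hsub y] at h
  exact exists_perm_of_map_univ_eq h

theorem typeOf_comp_perm {n M : ℕ} (x : Fin n → Fin M) (σ : Equiv.Perm (Fin n)) :
    typeOf (x ∘ σ) = typeOf x := by
  rw [typeOf, ← Multiset.map_map, Multiset.map_univ_val_equiv, typeOf]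

/-- On a type promise, a minimal sensitive block has size at most `3 * s(f)`. -/
theorem card_le_three_mul_sens {n M : ℕ} {T : Set (Fin n → Fin M)} (hT : IsTypePromise T)
    {f : (Fin n → Fin M) → Bool} {x : Fin n → Fin M} (hx : x ∈ T) {b : Finset (Fin n)}
    (hb : Minimal (SensBlock T f x) b) : b.card ≤ 3 * sens T f := by
  obtain ⟨x₀, rfl⟩ := hT
  obtain ⟨y, hy, hfy, hyb⟩ := hb.prop
  have hdiff : ∀ i ∈ b, y i ≠ x i := by
    intro i hi hyx
    have hle := hb.le_of_le (y := b.erase i) ⟨y, hy, hfy, fun k hk =>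
      Finset.mem_erase.2 ⟨fun h => hk (h ▸ hyx), hyb k hk⟩⟩ (Finset.erase_subset i b)
    exact Finset.notMem_erase i b (hle hi)
  obtain ⟨σ, hσ⟩ := exists_perm_of_typeOf_eq
    ((show typeOf x = typeOf x₀ from hx).trans (show typeOf y = typeOf x₀ from hy).symm) hyb
  have hfix : ∀ i, σ i ≠ i := fun i h => hdiff i i.2 (by simpa [h] using hσ i)
  obtain ⟨P, hP, hcard⟩ := exists_independent_of_fixedPointFree σ hfix
  rw [Fintype.card_coe] at hcard
  refine hcard.trans (Nat.mul_le_mul_left 3 (le_trans ?_ (sx_le_sens f hy)))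
  refine card_le_sx P (fun p => {(p : Fin n), (σ p : Fin n)}) (fun p hp => ⟨?_, ?_⟩) ?_
  · have hz : typeOf (y ∘ Equiv.swap (p : Fin n) (σ p)) = typeOf x₀ :=
      (typeOf_comp_perm _ _).trans hy
    refine ⟨_, hz, fun hfz => ?_, fun i hi => ?_⟩
    · have hle := hb.le_of_le (y := b.erase p) ⟨_, hz, hfz ▸ hfy, fun k hk => ?_⟩
        (Finset.erase_subset _ b)
      · exact Finset.notMem_erase _ b (hle p.2)
      · refine Finset.mem_erase.2 ⟨?_, ?_⟩
        · rintro rfl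
          exact hk (by simpa using hσ p)
        · by_cases h₁ : k = p
          · exact h₁ ▸ p.2
          by_cases h₂ : k = σ p
          · exact h₂ ▸ (σ p).2
          · exact hyb k (by simpa [Equiv.swap_apply_of_ne_of_ne h₁ h₂] using hk)
    · by_contra hmem
      simp only [Finset.mem_insert, Finset.mem_singleton, not_or] at hmem
      exact hi (by simp [Equiv.swap_apply_of_ne_of_ne hmem.1 hmem.2])
  · exact Finset.card_pair fun h => hfix p (Subtype.ext h.symm)
  · intro p hp q hq hpq
    rw [Finset.disjoint_left]
    intro i hi hi'
    simp only [Finset.mem_insert, Finset.mem_singleton] at hi hi'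
    rcases hi with rfl | rfl <;> rcases hi' with h | h
    · exact hpq (Subtype.ext h)
    · exact hP q hq (Subtype.ext h ▸ hp)
    · exact hP p hp (Subtype.ext h ▸ hq)
    · exact hpq (σ.injective (Subtype.ext h))

/-- Revealing the union of a maximum packing of sensitive blocks gives a certificate. -/
theorem Cx_le_card_biUnion {n M : ℕ} {X : Set (Fin n → Fin M)} {f : (Fin n → Fin M) → Bool}
    {x : Fin n → Fin M} (b : Fin (bsx X f x) → Finset (Fin n))
    (hb : ∀ j, SensBlock X f x (b j)) (hd : ∀ j j', j ≠ j' → Disjoint (b j) (b j')) :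
    Cx X f x ≤ (Finset.univ.biUnion b).card := by
  set U := Finset.univ.biUnion b with hU
  have key : ∀ y ∈ X, (∀ i ∈ U, y i = x i) → f y = f x := by
    intro y hy hyU
    by_contra hne
    have hdisj : ∀ j, Disjoint (Finset.univ.filter fun i => y i ≠ x i) (b j) := by
      intro j
      rw [Finset.disjoint_left]
      intro i hi hij
      exact (Finset.mem_filter.1 hi).2
        (hyU i (Finset.mem_biUnion.2 ⟨j, Finset.mem_univ j, hij⟩))
    have := le_bsx (X := X) (f := f) (x := x)
      (Fin.cons (Finset.univ.filter fun i => y i ≠ x i) b)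
      (fun j => by
        refine Fin.cases ?_ (fun j => ?_) j
        · exact ⟨y, hy, hne, fun i hi => by simpa using hi⟩
        · simpa using hb j)
      (fun j j' => by
        refine Fin.cases ?_ (fun j => ?_) j <;> refine Fin.cases ?_ (fun j' => ?_) j'
        · intro h
          exact absurd rfl h
        · intro _
          simpa only [Fin.cons_zero, Fin.cons_succ] using hdisj j'
        · intro _
          simpa only [Fin.cons_zero, Fin.cons_succ] using (hdisj j).symm
        · intro h
          simpa only [Fin.cons_succ] using hd j j' (fun e => h (congrArg Fin.succ e)))
    omega
  refine Nat.sInf_le ⟨fun i => if i ∈ U then some (x i) else none, ?_, ?_, ?_⟩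
  · intro y hy z hz hcy hcz
    rw [key y hy fun i hi => hcy i (x i) (if_pos hi), key z hz fun i hi => hcz i (x i) (if_pos hi)]
  · intro i a h
    by_cases hi : i ∈ U <;> simp_all
  · simp [paSize]

/-- on a type promise, `C(f) ≤ 3 · bs(f) · s(f)`. -/
theorem certC_le_three_bs_sens (n M : ℕ) (hn : 1 ≤ n) (hM : 1 ≤ M)
    (T : Set (Fin n → Fin M)) (hT : IsTypePromise T)
    (f : (Fin n → Fin M) → Bool) :
    certC T f ≤ 3 * bs T f * sens T f := by
  refine csSup_le' ?_
  rintro _ ⟨x, hx, rfl⟩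
  obtain ⟨b, hb, hd⟩ := Nat.sSup_mem (s := {m | ∃ b : Fin m → Finset (Fin n),
      (∀ j, SensBlock T f x (b j)) ∧ ∀ j j', j ≠ j' → Disjoint (b j) (b j')})
    ⟨0, Fin.elim0, fun j => j.elim0, fun j => j.elim0⟩ (bddAbove_packings T f x)
  choose c hcb hc using fun j => exists_minimal_le_of_wellFoundedLT (SensBlock T f x) (b j) (hb j)
  calc Cx T f x ≤ (Finset.univ.biUnion c).card :=
        Cx_le_card_biUnion c (fun j => (hc j).prop)
          fun j j' h => (hd j j' h).mono (hcb j) (hcb j')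
    _ ≤ (Finset.univ : Finset (Fin (bsx T f x))).card * (3 * sens T f) :=
        Finset.card_biUnion_le_card_mul _ _ _ fun j _ => card_le_three_mul_sens hT hx (hc j)
    _ = bsx T f x * (3 * sens T f) := by rw [Finset.card_fin]
    _ ≤ bs T f * (3 * sens T f) := Nat.mul_le_mul_right _ (bsx_le_bs f hx)
    _ = 3 * bs T f * sens T f := by ring

end QCPaper
end

section
/- Let B be a finite type and σ a permutation of B with no fixed points (σ a ≠ a for all a ∈ B). Then there exists a finite set A ⊆ B with 3 · |A| ≥ |B| such that the 2-element sets {a, σ a}, for a ∈ A, are pairwise disjoint. -/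
open scoped Classical

namespace QCPaper

/-- A finite set maximal among those `A` disjoint from their image `σ A` covers the whole type
together with its image and its preimage. -/
theorem exists_forall_apply_notMem_and_cover {B : Type*} [Fintype B] [DecidableEq B]
    (σ : Equiv.Perm B) (hσ : ∀ a : B, σ a ≠ a) :
    ∃ A : Finset B, (∀ a ∈ A, σ a ∉ A) ∧
      A ∪ A.image σ ∪ A.image σ.symm = Finset.univ := by
  obtain ⟨A, hA⟩ := (Set.toFinite {A : Finset B | ∀ a ∈ A, σ a ∉ A}).exists_maximal
    ⟨∅, by simp⟩
  refine ⟨A, hA.prop, Finset.eq_univ_of_forall fun b => ?_⟩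
  by_contra hb
  simp only [Finset.mem_union, Finset.mem_image, not_or, not_exists, not_and] at hb
  obtain ⟨⟨hbA, himage⟩, hpreimage⟩ := hb
  have hinsert : ∀ a ∈ insert b A, σ a ∉ insert b A := by
    intro a ha h
    rcases Finset.mem_insert.1 ha with rfl | ha <;> rcases Finset.mem_insert.1 h with h | h
    · exact hσ _ h
    · exact hpreimage _ h (σ.symm_apply_apply _)
    · exact himage _ ha h
    · exact hA.prop _ ha h
  exact hbA (hA.le_of_ge hinsert (Finset.subset_insert b A) (Finset.mem_insert_self b A))

/-- a fixed-point-free permutation `σ` of a finite type `B` admits a set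
`A` with `3·|A| ≥ |B|` such that the pairs `{a, σ a}`, `a ∈ A`, are pairwise disjoint. -/
theorem exists_disjoint_transposition_family {B : Type*} [Fintype B] [DecidableEq B]
    (σ : Equiv.Perm B) (hσ : ∀ a : B, σ a ≠ a) :
    ∃ A : Finset B, Fintype.card B ≤ 3 * A.card ∧
      ∀ a ∈ A, ∀ a' ∈ A, a ≠ a' →
        ({a, σ a} : Finset B) ∩ ({a', σ a'} : Finset B) = ∅ := by
  obtain ⟨A, hA, hcover⟩ := exists_forall_apply_notMem_and_cover σ hσ
  refine ⟨A, ?_, fun a ha a' ha' hne => ?_⟩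
  · rw [← Finset.card_univ, ← hcover]
    have h₁ := Finset.card_union_le (A ∪ A.image σ) (A.image σ.symm)
    have h₂ := Finset.card_union_le A (A.image σ)
    have h₃ := Finset.card_image_le (s := A) (f := σ)
    have h₄ := Finset.card_image_le (s := A) (f := σ.symm)
    omega
  · rw [← Finset.disjoint_iff_inter_eq_empty]
    simp only [Finset.disjoint_insert_left, Finset.disjoint_singleton_left,
      Finset.mem_insert, Finset.mem_singleton, not_or]
    exact ⟨⟨hne, fun h => hA a' ha' (h ▸ ha)⟩, fun h => hA a ha (h ▸ ha'),
      fun h => hne (σ.injective h)⟩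

end QCPaper
end

section
/- Let T ⊆ [M]^n be a type promise with multiplicity function m_T : Fin M → ℕ (m_T(a) is the number of occurrences of a in each element of T), and let f : T → Bool. Let k ∈ ℕ satisfy 1 ≤ k, 4k² ≤ D(f) (i.e., k ≤ (1/2)√D(f)), and k ≥ C(f). Then there exist a partial assignment p consistent with some element of T with size at most 4k², and a set S ⊆ Fin M with |S| ≤ 4k², such that: (i) for every a ∈ S, m_T(a) minus the number of indices i with p i = some a is less than 2k; and (ii) for every x ∈ T consistent with p and every certificate c for f that is consistent with x and has size at most k, there exists an index i with p i = none and c i = some a for some a ∈ S. -/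
open scoped Classical

namespace QCPaper

section Certificates

variable {n M : ℕ}

/-- The number of indices to which the partial assignment `p` gives the value `a`. -/
noncomputable def paMult (p : Fin n → Option (Fin M)) (a : Fin M) : ℕ :=
  (Finset.univ.filter fun i => p i = some a).card

/-- The indices at which `c` is defined and `p` is not. -/
noncomputable def newDom (p c : Fin n → Option (Fin M)) : Finset (Fin n) :=
  Finset.univ.filter fun i => p i = none ∧ c i ≠ none

/-- The indices outside the domain of `p` at which `c` has a value outside `S`. -/
noncomputable def newDomOff (p : Fin n → Option (Fin M)) (S : Finset (Fin M))
    (c : Fin n → Option (Fin M)) : Finset (Fin n) :=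
  Finset.univ.filter fun i => p i = none ∧ ∃ a, c i = some a ∧ a ∉ S

/-- The potential of a certificate `c` after the answers `p` and with marked values `S`. -/
noncomputable def potential (p : Fin n → Option (Fin M)) (S : Finset (Fin M))
    (c : Fin n → Option (Fin M)) : ℕ :=
  (newDom p c).card + (newDomOff p S c).card

/-- The extension of `p` by the values of `y` on `I`. -/
noncomputable def extend (p : Fin n → Option (Fin M)) (I : Finset (Fin n))
    (y : Fin n → Fin M) : Fin n → Option (Fin M) :=
  fun i => if i ∈ I then some (y i) else p i

lemma sum_mult (x : Fin n → Fin M) : ∑ a, mult x a = n := by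
  have h := Finset.card_eq_sum_card_fiberwise (s := (Finset.univ : Finset (Fin n)))
    (t := (Finset.univ : Finset (Fin M))) (f := x) (fun _ _ => by simp)
  simpa [mult] using h.symm

lemma sum_paMult (p : Fin n → Option (Fin M)) : ∑ a, paMult p a = paSize p := by
  unfold paMult paSize
  rw [← Finset.card_biUnion]
  · congr 1
    ext i
    simp [Option.ne_none_iff_exists']
  · intro a _ b _ hab
    rw [Function.onFun, Finset.disjoint_left]
    intro i hi hj
    simp only [Finset.mem_filter, Finset.mem_univ, true_and] at hi hj
    exact hab (Option.some.inj (hi.symm.trans hj))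

lemma exists_consistent_of_paMult_le (m : Fin M → ℕ) (hm : ∑ a, m a = n) (d : ℕ) :
    ∀ q : Fin n → Option (Fin M), (Finset.univ.filter fun i => q i = none).card = d →
      (∀ a, paMult q a ≤ m a) → ∃ x, (∀ a, mult x a = m a) ∧ Consistent q x := by
  induction d with
  | zero =>
    intro q hd hq
    have hsome : ∀ i, ∃ a, q i = some a := by
      intro i
      rw [Finset.card_eq_zero, Finset.filter_eq_empty_iff] at hd
      exact Option.ne_none_iff_exists'.mp (hd (Finset.mem_univ i))
    choose x hx using hsome
    have hmult : ∀ a, mult x a = paMult q a := by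
      intro a
      simp [mult, paMult, hx]
    refine ⟨x, ?_, ?_⟩
    · have h := (Finset.sum_eq_sum_iff_of_le (s := Finset.univ) (f := mult x) (g := m)
        (fun a _ => by rw [hmult]; exact hq a)).mp (by rw [sum_mult, hm])
      exact fun a => h a (Finset.mem_univ a)
    · intro i a h
      exact Option.some.inj ((hx i).symm.trans h)
  | succ d ih =>
    intro q hd hq
    obtain ⟨i, hi⟩ : (Finset.univ.filter fun i => q i = none).Nonempty := by
      rw [← Finset.card_pos]; omega
    have hqi : q i = none := by simpa using hi
    have hsplit : paSize q + (Finset.univ.filter fun i => q i = none).card = n := by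
      have h := Finset.card_filter_add_card_filter_not
        (s := (Finset.univ : Finset (Fin n))) (fun i => q i = none)
      simp only [Finset.card_univ, Fintype.card_fin] at h
      unfold paSize
      simp only [ne_eq]
      omega
    obtain ⟨a, -, ha⟩ : ∃ a ∈ Finset.univ, paMult q a < m a := by
      apply Finset.exists_lt_of_sum_lt
      rw [sum_paMult, hm]
      omega
    obtain ⟨x, hx, hc⟩ := ih (Function.update q i (some a)) (by
        have h : (Finset.univ.filter fun j => Function.update q i (some a) j = none) =
            (Finset.univ.filter fun j => q j = none).erase i := by
          ext j
          by_cases hj : j = i <;> simp [hj, Function.update_apply]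
        rw [h, Finset.card_erase_of_mem hi, hd]
        rfl) (by
        intro b
        by_cases hb : b = a
        · subst hb
          have h : (Finset.univ.filter fun j => Function.update q i (some b) j = some b) ⊆
              insert i (Finset.univ.filter fun j => q j = some b) := by
            intro j
            by_cases hj : j = i <;> simp [hj, Function.update_apply]
          have h' := (Finset.card_le_card h).trans (Finset.card_insert_le _ _)
          exact h'.trans ha
        · refine le_trans (Finset.card_le_card ?_) (hq b)
          intro j
          by_cases hj : j = i <;> simp [hj, Function.update_apply, Ne.symm hb])
    refine ⟨x, hx, fun j b hj => hc j b ?_⟩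
    have hji : j ≠ i := by
      rintro rfl
      simp [hqi] at hj
    simpa [Function.update_apply, hji] using hj

lemma card_newDom_le (p c : Fin n → Option (Fin M)) : (newDom p c).card ≤ paSize c := by
  apply Finset.card_le_card
  intro i
  simp only [newDom, Finset.mem_filter, Finset.mem_univ, true_and]
  exact fun h => h.2

lemma potential_le (p : Fin n → Option (Fin M)) (S : Finset (Fin M))
    (c : Fin n → Option (Fin M)) : potential p S c ≤ 2 * paSize c := by
  have h : (newDomOff p S c).card ≤ (newDom p c).card := by
    apply Finset.card_le_card
    intro i
    simp only [newDom, newDomOff, Finset.mem_filter, Finset.mem_univ, true_and]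
    rintro ⟨h, a, ha, -⟩
    exact ⟨h, by simp [ha]⟩
  have := card_newDom_le p c
  unfold potential
  omega

lemma exists_certificate {T : Set (Fin n → Fin M)} {f : (Fin n → Fin M) → Bool} {k : ℕ}
    (hC : certC T f ≤ k) {x : Fin n → Fin M} (hx : x ∈ T) :
    ∃ c, IsCertificate T f c ∧ Consistent c x ∧ paSize c ≤ k := by
  have hfull : ∀ y : Fin n → Fin M,
      ∃ c, IsCertificate T f c ∧ Consistent c y ∧ paSize c = n := by
    intro y
    refine ⟨fun i => some (y i), ?_, ?_, by simp [paSize]⟩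
    · intro u _ v _ hu hv
      congr 1
      ext i
      rw [hu i _ rfl, hv i _ rfl]
    · intro i a h
      exact Option.some.inj h
  obtain ⟨c, hc, hcx, hsize⟩ := Nat.sInf_mem (⟨n, hfull x⟩ : {k | ∃ c : Fin n → Option (Fin M),
    IsCertificate T f c ∧ Consistent c x ∧ paSize c = k}.Nonempty)
  refine ⟨c, hc, hcx, ?_⟩
  rw [hsize]
  have hbdd : BddAbove {k | ∃ y ∈ T, Cx T f y = k} := by
    refine ⟨n, ?_⟩
    rintro _ ⟨y, -, rfl⟩
    exact Nat.sInf_le (hfull y)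
  exact (le_csSup hbdd ⟨x, hx, rfl⟩).trans hC

/-- Two certificates for different values, each compatible with `p`, either disagree at an
index outside `p` or share a value of small residual multiplicity outside `p`. -/
lemma certificates_conflict {T : Set (Fin n → Fin M)} {m : Fin M → ℕ}
    (hT : ∀ x, x ∈ T ↔ ∀ a, mult x a = m a) {f : (Fin n → Fin M) → Bool} {k : ℕ}
    (hk : 1 ≤ k) {p c c' : Fin n → Option (Fin M)} {x x' : Fin n → Fin M}
    (hx : x ∈ T) (hx' : x' ∈ T) (hpx : Consistent p x) (hpx' : Consistent p x')
    (hc : IsCertificate T f c) (hc' : IsCertificate T f c') (hcx : Consistent c x)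
    (hcx' : Consistent c' x') (hsize : paSize c ≤ k) (hsize' : paSize c' ≤ k)
    (hf : f x ≠ f x') :
    (∃ i, i ∈ newDom p c ∧ i ∈ newDom p c') ∨
      ∃ a i i', p i = none ∧ p i' = none ∧ c i = some a ∧ c' i' = some a ∧
        m a - paMult p a < 2 * k := by
  by_contra! h
  obtain ⟨hdisj, hmult⟩ := h
  set q : Fin n → Option (Fin M) :=
    fun i => if p i = none then (if c i = none then c' i else c i) else p i with hq
  have hqc : ∀ z, Consistent q z → Consistent c z := by
    intro z hz i a hi
    apply hz i a
    rcases hp : p i with _ | b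
    · simp [hq, hp, hi]
    · have h1 := hpx i b hp
      have h2 := hcx i a hi
      simp [hq, hp, ← h1, h2]
  have hqc' : ∀ z, Consistent q z → Consistent c' z := by
    intro z hz i a hi
    apply hz i a
    rcases hp : p i with _ | b
    · have h1 := hdisj i
      have h2 : c i = none := by
        by_contra h3
        exact h1 (by simp [newDom, hp, h3]) (by simp [newDom, hp, hi])
      simp [hq, hp, h2, hi]
    · have h1 := hpx' i b hp
      have h2 := hcx' i a hi
      simp [hq, hp, ← h1, h2]
  obtain ⟨a, ha⟩ : ∃ a, m a < paMult q a := by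
    by_contra! hle
    obtain ⟨z, hzm, hz⟩ := exists_consistent_of_paMult_le m
      (by rw [← sum_mult x]; exact Finset.sum_congr rfl fun a _ => ((hT x).mp hx a).symm)
      _ q rfl hle
    have hzT := (hT z).mpr hzm
    exact hf ((hc x hx z hzT hcx (hqc z hz)).trans (hc' z hzT x' hx' (hqc' z hz) hcx'))
  have hcount : paMult q a ≤ paMult p a + (newDom p c).card + (newDom p c').card := by
    refine le_trans (Finset.card_le_card (t := (Finset.univ.filter fun i => p i = some a) ∪
      newDom p c ∪ newDom p c') ?_) ((Finset.card_union_le _ _).trans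
        (Nat.add_le_add_right (Finset.card_union_le _ _) _))
    intro i
    simp only [Finset.mem_filter, Finset.mem_univ, true_and, Finset.mem_union, newDom, hq]
    by_cases hp : p i = none <;> by_cases h1 : c i = none <;> simp +contextual [hp, h1]
  have hi : ∃ i, p i = none ∧ c i = some a := by
    by_contra! hno
    have hle : paMult q a ≤ mult x' a := by
      apply Finset.card_le_card
      intro i
      simp only [Finset.mem_filter, Finset.mem_univ, true_and, hq]
      split_ifs with hp h1
      · exact hcx' i a
      · exact fun h2 => absurd h2 (hno i hp)
      · exact hpx' i a
    rw [(hT x').mp hx' a] at hle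
    omega
  have hi' : ∃ i, p i = none ∧ c' i = some a := by
    by_contra! hno
    have hle : paMult q a ≤ mult x a := by
      apply Finset.card_le_card
      intro i
      simp only [Finset.mem_filter, Finset.mem_univ, true_and, hq]
      split_ifs with hp h1
      · exact fun h2 => absurd h2 (hno i hp)
      · exact hcx i a
      · exact hpx i a
    rw [(hT x).mp hx a] at hle
    omega
  obtain ⟨i, hpi, hci⟩ := hi
  obtain ⟨i', hpi', hci'⟩ := hi'
  have h1 := hmult a i i' hpi hpi' hci hci'
  have h2 := card_newDom_le p c
  have h3 := card_newDom_le p c'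
  omega

lemma exists_tree_of_query (f : (Fin n → Fin M) → Bool) (d : ℕ) (I : Finset (Fin n)) :
    ∀ X : Set (Fin n → Fin M),
      (∀ y ∈ X, ∃ t : DTree n M, Computes {x | x ∈ X ∧ ∀ i ∈ I, x i = y i} f t ∧ t.depth ≤ d) →
      ∃ t : DTree n M, Computes X f t ∧ t.depth ≤ I.card + d := by
  induction I using Finset.induction_on with
  | empty =>
    intro X h
    rcases X.eq_empty_or_nonempty with rfl | ⟨y, hy⟩
    · exact ⟨.leaf true, fun x hx => hx.elim, by simp [DTree.depth]⟩
    · obtain ⟨t, ht, hd⟩ := h y hy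
      exact ⟨t, fun x hx => ht x ⟨hx, by simp⟩, by simpa using hd⟩
  | insert i I hi ih =>
    intro X h
    have hsub : ∀ a, ∃ t : DTree n M,
        Computes {x | x ∈ X ∧ x i = a} f t ∧ t.depth ≤ I.card + d := by
      intro a
      apply ih
      rintro y ⟨hy, rfl⟩
      obtain ⟨t, ht, hd⟩ := h y hy
      refine ⟨t, ?_, hd⟩
      rintro x ⟨⟨hx, hxi⟩, hI⟩
      refine ht x ⟨hx, fun j hj => ?_⟩
      rcases Finset.mem_insert.mp hj with rfl | hj
      · exact hxi
      · exact hI j hj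
    choose ts hts hd using hsub
    refine ⟨.node i ts, fun x hx => hts (x i) x ⟨hx, rfl⟩, ?_⟩
    have : (Finset.univ.sup fun a => (ts a).depth) ≤ I.card + d :=
      Finset.sup_le fun a _ => hd a
    rw [Finset.card_insert_of_notMem hi]
    simp only [DTree.depth]
    omega

lemma extend_eq_none {p : Fin n → Option (Fin M)} {I : Finset (Fin n)} {y : Fin n → Fin M}
    {i : Fin n} : extend p I y i = none ↔ i ∉ I ∧ p i = none := by
  unfold extend
  split_ifs with h <;> simp [h]

lemma consistent_extend_iff {p : Fin n → Option (Fin M)} {I : Finset (Fin n)}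
    (hI : ∀ i ∈ I, p i = none) {x y : Fin n → Fin M} :
    Consistent (extend p I y) x ↔ Consistent p x ∧ ∀ i ∈ I, x i = y i := by
  constructor
  · intro h
    refine ⟨fun i a hi => h i a ?_, fun i hi => h i _ (by simp [extend, hi])⟩
    have : i ∉ I := fun h' => by simp [hI i h'] at hi
    simp [extend, this, hi]
  · rintro ⟨hp, hx⟩ i a
    unfold extend
    split_ifs with h
    · rintro ⟨⟩
      exact hx i h
    · exact hp i a

lemma paMult_le_paMult_extend {p : Fin n → Option (Fin M)} {I : Finset (Fin n)}
    (hI : ∀ i ∈ I, p i = none) (y : Fin n → Fin M) (a : Fin M) :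
    paMult p a ≤ paMult (extend p I y) a := by
  apply Finset.card_le_card
  intro i
  simp only [Finset.mem_filter, Finset.mem_univ, true_and]
  intro hi
  have : i ∉ I := fun h' => by simp [hI i h'] at hi
  simp [extend, this, hi]

lemma paSize_extend_le (p : Fin n → Option (Fin M)) (I : Finset (Fin n))
    (y : Fin n → Fin M) : paSize (extend p I y) ≤ paSize p + I.card := by
  refine le_trans (Finset.card_le_card
    (t := (Finset.univ.filter fun i => p i ≠ none) ∪ I) ?_) (Finset.card_union_le _ _)
  intro i
  simp only [Finset.mem_filter, Finset.mem_univ, true_and, ne_eq, extend_eq_none,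
    Finset.mem_union]
  tauto

lemma newDom_extend_subset (p c : Fin n → Option (Fin M)) (I : Finset (Fin n))
    (y : Fin n → Fin M) : newDom (extend p I y) c ⊆ newDom p c := by
  intro i
  simp only [newDom, Finset.mem_filter, Finset.mem_univ, true_and, extend_eq_none]
  tauto

lemma newDomOff_extend_subset (p c : Fin n → Option (Fin M)) (I : Finset (Fin n))
    (y : Fin n → Fin M) {S S' : Finset (Fin M)} (hS : S ⊆ S') :
    newDomOff (extend p I y) S' c ⊆ newDomOff p S c := by
  intro i
  simp only [newDomOff, Finset.mem_filter, Finset.mem_univ, true_and, extend_eq_none]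
  rintro ⟨⟨-, h⟩, a, ha, haS⟩
  exact ⟨h, a, ha, fun h' => haS (hS h')⟩

lemma potential_extend_le (p c : Fin n → Option (Fin M)) (I : Finset (Fin n))
    (y : Fin n → Fin M) {S S' : Finset (Fin M)} (hS : S ⊆ S') :
    potential (extend p I y) S' c ≤ potential p S c :=
  Nat.add_le_add (Finset.card_le_card (newDom_extend_subset p c I y))
    (Finset.card_le_card (newDomOff_extend_subset p c I y hS))

/-- The values of `c` outside `p` whose residual multiplicity is below `2 * k`. -/
noncomputable def scarceValues (m : Fin M → ℕ) (k : ℕ) (p c : Fin n → Option (Fin M)) :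
    Finset (Fin M) :=
  Finset.univ.filter fun a => (∃ i, p i = none ∧ c i = some a) ∧ m a - paMult p a < 2 * k

lemma card_scarceValues_le (m : Fin M → ℕ) (k : ℕ) (p c : Fin n → Option (Fin M)) :
    (scarceValues m k p c).card ≤ paSize c := by
  have h : (scarceValues m k p c).map Function.Embedding.some ⊆ (newDom p c).image c := by
    intro o
    simp only [scarceValues, newDom, Finset.mem_map, Finset.mem_image, Finset.mem_filter,
      Finset.mem_univ, true_and]
    rintro ⟨a, ⟨⟨i, hp, hc⟩, -⟩, rfl⟩
    exact ⟨i, ⟨hp, by simp [hc]⟩, hc⟩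
  have h' := (Finset.card_le_card h).trans Finset.card_image_le
  rw [Finset.card_map] at h'
  exact h'.trans (card_newDom_le p c)

lemma potential_extend_lt {T : Set (Fin n → Fin M)} {m : Fin M → ℕ}
    (hT : ∀ x, x ∈ T ↔ ∀ a, mult x a = m a) {f : (Fin n → Fin M) → Bool} {k : ℕ}
    (hk : 1 ≤ k) {p c c' : Fin n → Option (Fin M)} {x x' : Fin n → Fin M}
    (hx : x ∈ T) (hx' : x' ∈ T) (hpx : Consistent p x) (hpx' : Consistent p x')
    (hc : IsCertificate T f c) (hc' : IsCertificate T f c') (hcx : Consistent c x)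
    (hcx' : Consistent c' x') (hsize : paSize c ≤ k) (hsize' : paSize c' ≤ k)
    (hf : f x ≠ f x') {S : Finset (Fin M)}
    (hS : ∀ i, ∀ a ∈ S, p i = none → c i ≠ some a) (y : Fin n → Fin M) :
    potential (extend p (newDom p c) y) (S ∪ scarceValues m k p c) c' < potential p S c' := by
  rcases certificates_conflict hT hk hx hx' hpx hpx' hc hc' hcx hcx' hsize hsize' hf with
    ⟨i, hi, hi'⟩ | ⟨a, i, i', hpi, hpi', hci, hci', ha⟩
  · refine Nat.add_lt_add_of_lt_of_le (Finset.card_lt_card ?_)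
      (Finset.card_le_card (newDomOff_extend_subset p c' _ y Finset.subset_union_left))
    refine (Finset.ssubset_iff_of_subset (newDom_extend_subset p c' _ y)).mpr ⟨i, hi', ?_⟩
    intro h
    simp only [newDom, Finset.mem_filter, Finset.mem_univ, true_and, extend_eq_none] at h hi
    exact h.1.1 hi
  · refine Nat.add_lt_add_of_le_of_lt
      (Finset.card_le_card (newDom_extend_subset p c' _ y)) (Finset.card_lt_card ?_)
    refine (Finset.ssubset_iff_of_subset
      (newDomOff_extend_subset p c' _ y Finset.subset_union_left)).mpr ⟨i', ?_, ?_⟩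
    · simp only [newDomOff, Finset.mem_filter, Finset.mem_univ, true_and]
      exact ⟨hpi', a, hci', fun h => hS i a h hpi hci⟩
    · simp only [newDomOff, Finset.mem_filter, Finset.mem_univ, true_and, not_and]
      rintro - ⟨b, hb, hbS⟩
      obtain rfl : a = b := Option.some.inj (hci'.symm.trans hb)
      apply hbS
      simp only [Finset.mem_union, scarceValues, Finset.mem_filter, Finset.mem_univ, true_and]
      exact Or.inr ⟨⟨i, hpi, hci⟩, ha⟩

lemma eq_of_newDom_eq_empty {T : Set (Fin n → Fin M)} {f : (Fin n → Fin M) → Bool}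
    {p c : Fin n → Option (Fin M)} {x y : Fin n → Fin M} (hx : x ∈ T) (hy : y ∈ T)
    (hpx : Consistent p x) (hpy : Consistent p y) (hc : IsCertificate T f c)
    (hcx : Consistent c x) (h : newDom p c = ∅) : f y = f x := by
  refine hc y hy x hx (fun i a hi => ?_) hcx
  have hp : p i ≠ none := by
    intro hp
    have : i ∈ newDom p c := by simp [newDom, hp, hi]
    simp [h] at this
  obtain ⟨b, hb⟩ := Option.ne_none_iff_exists'.mp hp
  rw [hpy i b hb, ← hpx i b hb, hcx i a hi]

lemma exists_leaf_of_bound_eq_zero {T : Set (Fin n → Fin M)} {f : (Fin n → Fin M) → Bool}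
    {k : ℕ} (hC : certC T f ≤ k) {p : Fin n → Option (Fin M)} {S : Finset (Fin M)} {b : Bool}
    (h : ∀ x ∈ T, Consistent p x → f x = b → ∀ c, IsCertificate T f c → Consistent c x →
      paSize c ≤ k → potential p S c ≤ 0) :
    ∃ b', Computes {x | x ∈ T ∧ Consistent p x} f (.leaf b' : DTree n M) := by
  by_cases hex : ∃ x ∈ T, Consistent p x ∧ f x = b
  · obtain ⟨x, hx, hpx, hfx⟩ := hex
    obtain ⟨c, hc, hcx, hsize⟩ := exists_certificate hC hx
    have h0 := h x hx hpx hfx c hc hcx hsize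
    have hempty : newDom p c = ∅ := by
      rw [← Finset.card_eq_zero]
      unfold potential at h0
      omega
    exact ⟨f x, fun y hy => (eq_of_newDom_eq_empty hx hy.1 hpx hy.2 hc hcx hempty).symm⟩
  · refine ⟨!b, fun y hy => ?_⟩
    have : f y ≠ b := fun hb => hex ⟨y, hy.1, hy.2, hb⟩
    simp only [DTree.eval]
    cases b <;> simp_all

/-- If every admissible pair `(p, S)` leaves some small certificate avoiding `S` outside `p`,
then querying such certificates repeatedly yields a shallow decision tree. -/
lemma exists_tree_of_potential {T : Set (Fin n → Fin M)} {m : Fin M → ℕ}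
    (hT : ∀ x, x ∈ T ↔ ∀ a, mult x a = m a) {f : (Fin n → Fin M) → Bool} {k B : ℕ}
    (hk : 1 ≤ k) (hC : certC T f ≤ k)
    (H : ∀ (p : Fin n → Option (Fin M)) (S : Finset (Fin M)), (∃ x ∈ T, Consistent p x) →
      paSize p ≤ B → S.card ≤ B → (∀ a ∈ S, m a - paMult p a < 2 * k) →
      ∃ x ∈ T, Consistent p x ∧ ∃ c, IsCertificate T f c ∧ Consistent c x ∧ paSize c ≤ k ∧
        ∀ i, ∀ a ∈ S, p i = none → c i ≠ some a) (N : ℕ) :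
    ∀ (p : Fin n → Option (Fin M)) (S : Finset (Fin M)) (s : Bool → ℕ),
      s true + s false ≤ N + 1 → paSize p + k * N ≤ B → S.card + k * N ≤ B →
      (∀ a ∈ S, m a - paMult p a < 2 * k) →
      (∀ b, ∀ x ∈ T, Consistent p x → f x = b → ∀ c, IsCertificate T f c → Consistent c x →
        paSize c ≤ k → potential p S c ≤ s b) →
      ∃ t : DTree n M, Computes {x | x ∈ T ∧ Consistent p x} f t ∧ t.depth ≤ k * N := by
  have leafCase : ∀ (N : ℕ) (p : Fin n → Option (Fin M)) (S : Finset (Fin M)) (s : Bool → ℕ)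
      (b : Bool), s b = 0 →
      (∀ b, ∀ x ∈ T, Consistent p x → f x = b → ∀ c, IsCertificate T f c → Consistent c x →
        paSize c ≤ k → potential p S c ≤ s b) →
      ∃ t : DTree n M, Computes {x | x ∈ T ∧ Consistent p x} f t ∧ t.depth ≤ k * N := by
    intro N p S s b hb hpot
    obtain ⟨b', hb'⟩ := exists_leaf_of_bound_eq_zero (b := b) hC (hb ▸ hpot b)
    exact ⟨.leaf b', hb', by simp [DTree.depth]⟩
  induction N with
  | zero =>
    intro p S s hs _ _ _ hpot
    have : ∃ b, s b = 0 := by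
      by_contra! h
      have := h true
      have := h false
      omega
    obtain ⟨b, hb⟩ := this
    exact leafCase 0 p S s b hb hpot
  | succ N ih =>
    intro p S s hs hpB hSB hSm hpot
    by_cases hzero : ∃ b, s b = 0
    · obtain ⟨b, hb⟩ := hzero
      exact leafCase (N + 1) p S s b hb hpot
    push Not at hzero
    by_cases hne : ∃ x ∈ T, Consistent p x
    swap
    · exact ⟨.leaf true, fun x hx => absurd ⟨x, hx.1, hx.2⟩ hne, by simp [DTree.depth]⟩
    rw [Nat.mul_succ] at hpB hSB
    obtain ⟨x, hx, hpx, c, hc, hcx, hsize, hcS⟩ := H p S hne (by omega) (by omega) hSm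
    have hI : ∀ i ∈ newDom p c, p i = none := fun i hi => (Finset.mem_filter.mp hi).2.1
    have hIcard := (card_newDom_le p c).trans hsize
    obtain ⟨t, ht, hd⟩ := exists_tree_of_query f (k * N) (newDom p c)
      {x | x ∈ T ∧ Consistent p x} (by
        rintro y -
        obtain ⟨t, ht, hd⟩ := ih (extend p (newDom p c) y) (S ∪ scarceValues m k p c)
          (Function.update s (!f x) (s (!f x) - 1)) (by
            have h1 := hzero true
            have h2 := hzero false
            cases f x <;> simp <;> omega) (by
            have := paSize_extend_le p (newDom p c) y
            omega) (by
            have h1 := Finset.card_union_le S (scarceValues m k p c)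
            have h2 := card_scarceValues_le m k p c
            omega) (by
            intro a ha
            have h1 := paMult_le_paMult_extend hI y a
            have h2 : m a - paMult p a < 2 * k := by
              rcases Finset.mem_union.mp ha with ha | ha
              · exact hSm a ha
              · exact (Finset.mem_filter.mp ha).2.2
            omega) (by
            rintro b x' hx' hpx' rfl c' hc' hcx' hsize'
            have hpx'' := ((consistent_extend_iff hI).mp hpx').1
            have hold := hpot _ x' hx' hpx'' rfl c' hc' hcx' hsize'
            by_cases hf : f x = f x'
            · have hne : f x' ≠ !f x := by rw [hf]; cases f x' <;> simp
              rw [Function.update_of_ne hne]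
              exact (potential_extend_le p c' _ y Finset.subset_union_left).trans hold
            · have heq : f x' = !f x := by
                revert hf; cases f x <;> cases f x' <;> simp
              have hlt := potential_extend_lt hT hk hx hx' hpx hpx'' hc hc' hcx hcx' hsize
                hsize' hf hcS y
              rw [← heq, Function.update_self]
              omega)
        refine ⟨t, ?_, hd⟩
        rintro z ⟨⟨hz, hpz⟩, hzI⟩
        exact ht z ⟨hz, (consistent_extend_iff hI).mpr ⟨hpz, hzI⟩⟩)
    exact ⟨t, ht, by rw [Nat.mul_succ]; omega⟩

end Certificates

/-- the technical lemma about the structure of small certificates on a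
type promise with multiplicity function `mT`. -/
theorem small_certificate_structure (n M : ℕ) (hn : 1 ≤ n) (hM : 1 ≤ M)
    (T : Set (Fin n → Fin M)) (mT : Fin M → ℕ)
    (hTne : T.Nonempty) (hT : T = {x | ∀ a : Fin M, mult x a = mT a})
    (f : (Fin n → Fin M) → Bool)
    (k : ℕ) (hk1 : 1 ≤ k) (hkD : 4 * k ^ 2 ≤ detD T f) (hkC : certC T f ≤ k) :
    ∃ (p : Fin n → Option (Fin M)) (S : Finset (Fin M)),
      (∃ x ∈ T, Consistent p x) ∧
      paSize p ≤ 4 * k ^ 2 ∧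
      S.card ≤ 4 * k ^ 2 ∧
      (∀ a ∈ S, mT a - (Finset.univ.filter fun i => p i = some a).card < 2 * k) ∧
      (∀ x ∈ T, Consistent p x →
        ∀ c : Fin n → Option (Fin M),
          IsCertificate T f c → Consistent c x → paSize c ≤ k →
            ∃ i : Fin n, ∃ a ∈ S, p i = none ∧ c i = some a) := by
  have hTiff : ∀ x, x ∈ T ↔ ∀ a, mult x a = mT a := fun x => by rw [hT]; rfl
  by_contra hcon
  have H : ∀ (p : Fin n → Option (Fin M)) (S : Finset (Fin M)), (∃ x ∈ T, Consistent p x) →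
      paSize p ≤ 4 * k ^ 2 → S.card ≤ 4 * k ^ 2 → (∀ a ∈ S, mT a - paMult p a < 2 * k) →
      ∃ x ∈ T, Consistent p x ∧ ∃ c, IsCertificate T f c ∧ Consistent c x ∧ paSize c ≤ k ∧
        ∀ i, ∀ a ∈ S, p i = none → c i ≠ some a := by
    intro p S hp hsize hcard hS
    by_contra! h
    refine hcon ⟨p, S, hp, hsize, hcard, hS, fun x hx hpx c hc hcx hck => ?_⟩
    exact h x hx hpx c hc hcx hck
  have hN : k * (4 * k - 1) + k = 4 * k ^ 2 := by
    obtain ⟨j, rfl⟩ : ∃ j, k = j + 1 := ⟨k - 1, by omega⟩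
    have : 4 * (j + 1) - 1 = 4 * j + 3 := by omega
    rw [this]
    ring
  obtain ⟨t, ht, hd⟩ := exists_tree_of_potential hTiff hk1 hkC H (4 * k - 1)
    (fun _ => none) ∅ (fun _ => 2 * k) (by omega) (by simp [paSize]; omega)
    (by simp; omega) (by simp) (by
      intro b x _ _ _ c _ _ hsize
      have := potential_le (fun _ => none) ∅ c
      omega)
  have hle : detD T f ≤ t.depth :=
    Nat.sInf_le ⟨t, fun x hx => ht x ⟨hx, fun i a h => by simp at h⟩, rfl⟩
  omega

end QCPaper
end
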